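/- Fix M, C ≥ 0, m ∈ ℕ, weights b_1,…,b_m ∈ ℝ with Σ_{k=1}^m b_k = 1 and Σ_{k=1}^m b_k c_k = 1/2, and nodes c_1,…,c_m ∈ [0,1]. There is a constant K, depending only on M, C and the weights, such that the following holds. Let E be a real Banach space, τ > 0, let T : [0,τ] → L(E) be a family of bounded linear operators on E and A : E → E a bounded linear operator satisfying: (i) ‖T_t‖ ≤ M for all t ∈ [0,τ]; (ii) for every x ∈ E the map t ↦ T_t x is differentiable on [0,τ] with derivative A(T_t x); (iii) A(T_t x) = T_t(A x) for all t ∈ [0,τ] and x ∈ E; (iv) ‖A ∘ T_t‖ ≤ C/t for all t ∈ (0,τ]. Let ψ̂ : [0,τ] → E be twice continuously differentiable with ‖ψ̂(s)‖ ≤ C, ‖ψ̂′(s)‖ ≤ C and ‖ψ̂″(s)‖ ≤ C for all s ∈ [0,τ], and suppose there exists φ₀ ∈ E with ‖A φ₀‖ ≤ C and ‖ψ̂(s) − φ₀‖ ≤ C τ for all s ∈ [0,τ]. Set ψ(s) = T_{τ−s}(ψ̂(s)). Then there exist w, r ∈ E such that ∫₀^τ ψ(s) ds − τ Σ_{k=1}^m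 b_k ψ(τ c_k) = A(w) + r, with ‖w‖ ≤ K τ³ and ‖r‖ ≤ K τ³. -/

import Mathlib

open Set Filter Topology MeasureTheory

/-- Joint continuity of a bounded strongly convergent family. -/
lemma quad_tendsto_apply {E : Type*} [NormedAddCommGroup E] [NormedSpace ℝ E]
    {l : Filter ℝ} {S : ℝ → E →L[ℝ] E} {S₀ : E →L[ℝ] E} {M : ℝ} {v : ℝ → E} {v₀ : E}
    (hS : ∀ᶠ y in l, ‖S y‖ ≤ M) (hS0 : Tendsto (fun y => S y v₀) l (𝓝 (S₀ v₀)))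
    (hv : Tendsto v l (𝓝 v₀)) :
    Tendsto (fun y => S y (v y)) l (𝓝 (S₀ v₀)) := by
  have h1 : Tendsto (fun y => S y (v y - v₀)) l (𝓝 0) := by
    apply squeeze_zero_norm' (a := fun y => M * ‖v y - v₀‖)
    · filter_upwards [hS] with y hy
      exact (S y).le_of_opNorm_le hy _
    · have : Tendsto (fun y => M * ‖v y - v₀‖) l (𝓝 (M * ‖v₀ - v₀‖)) :=
        ((hv.sub_const v₀).norm).const_mul M
      simpa using this
  have h2 := h1.add hS0
  simpa using h2

/-- Product rule for `s ↦ T (τ - s) (u s)`. -/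
lemma quad_hasDeriv {E : Type*} [NormedAddCommGroup E] [NormedSpace ℝ E]
    {τ M : ℝ} {T : ℝ → E →L[ℝ] E} {A : E →L[ℝ] E}
    (hTM : ∀ t ∈ Icc (0:ℝ) τ, ‖T t‖ ≤ M)
    (hTd : ∀ x : E, ∀ t ∈ Icc (0:ℝ) τ,
          HasDerivWithinAt (fun s => T s x) (A (T t x)) (Icc (0:ℝ) τ) t)
    (hcomm : ∀ t ∈ Icc (0:ℝ) τ, ∀ x : E, A (T t x) = T t (A x))
    {u : ℝ → E} {u' : E} {s : ℝ} (hs : s ∈ Icc (0:ℝ) τ)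
    (hu : HasDerivWithinAt u u' (Icc (0:ℝ) τ) s) :
    HasDerivWithinAt (fun s => T (τ - s) (u s)) (T (τ - s) (u' - A (u s))) (Icc (0:ℝ) τ) s := by
  have hmaps : MapsTo (fun y => τ - y) (Icc (0:ℝ) τ) (Icc (0:ℝ) τ) := by
    intro y hy
    exact ⟨by linarith [hy.2], by linarith [hy.1]⟩
  have hs' : τ - s ∈ Icc (0:ℝ) τ := hmaps hs
  have hd : ∀ x : E, HasDerivWithinAt (fun y => T (τ - y) x) (-(A (T (τ - s) x)))
      (Icc (0:ℝ) τ) s := by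
    intro x
    have h1 : HasDerivWithinAt (fun y : ℝ => τ - y) (-1) (Icc (0:ℝ) τ) s :=
      (hasDerivWithinAt_id s _).const_sub τ
    have h2 := HasDerivWithinAt.scomp s (hTd x (τ - s) hs') h1 hmaps
    simpa [Function.comp_def] using h2
  rw [hasDerivWithinAt_iff_tendsto_slope] at hu ⊢
  have e1 := (hasDerivWithinAt_iff_tendsto_slope.1 (hd (u s)))
  have e2 : Tendsto (fun y => T (τ - y) (slope u s y)) (𝓝[Icc (0:ℝ) τ \ {s}] s)
      (𝓝 (T (τ - s) u')) := by
    refine quad_tendsto_apply (M := M) ?_ ?_ hu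
    · filter_upwards [self_mem_nhdsWithin] with y hy
      exact hTM _ (hmaps hy.1)
    · exact ((hd u').continuousWithinAt).mono_left (nhdsWithin_mono _ sdiff_subset)
  have e3 := e1.add e2
  have : -(A (T (τ - s) (u s))) + T (τ - s) u' = T (τ - s) (u' - A (u s)) := by
    rw [hcomm _ hs', map_sub]; abel
  rw [this] at e3
  refine e3.congr fun y => ?_
  simp only [slope_def_module, map_smul, map_sub]
  rw [← smul_add]
  congr 1
  abel

lemma quad_continuousOn {E : Type*} [NormedAddCommGroup E] [NormedSpace ℝ E]
    {τ M : ℝ} {T : ℝ → E →L[ℝ] E} {A : E →L[ℝ] E}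
    (hTM : ∀ t ∈ Icc (0:ℝ) τ, ‖T t‖ ≤ M)
    (hTd : ∀ x : E, ∀ t ∈ Icc (0:ℝ) τ,
          HasDerivWithinAt (fun s => T s x) (A (T t x)) (Icc (0:ℝ) τ) t)
    {u : ℝ → E} (hu : ContinuousOn u (Icc (0:ℝ) τ)) :
    ContinuousOn (fun s => T (τ - s) (u s)) (Icc (0:ℝ) τ) := by
  have hmaps : MapsTo (fun y => τ - y) (Icc (0:ℝ) τ) (Icc (0:ℝ) τ) := by
    intro y hy
    exact ⟨by linarith [hy.2], by linarith [hy.1]⟩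
  intro s hs
  refine quad_tendsto_apply (M := M) ?_ ?_ (hu s hs)
  · filter_upwards [self_mem_nhdsWithin] with y hy
    exact hTM _ (hmaps hy)
  · have h1 : ContinuousWithinAt (fun y : ℝ => τ - y) (Icc (0:ℝ) τ) s := by fun_prop
    exact ContinuousWithinAt.comp (f := fun y : ℝ => τ - y) (g := fun t => T t (u s))
      ((hTd (u s) (τ - s) (hmaps hs)).continuousWithinAt) h1 hmaps

/-- Taylor formula with integral remainder on an interval. -/
lemma quad_taylor {E : Type*} [NormedAddCommGroup E] [NormedSpace ℝ E] [CompleteSpace E]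
    {τ : ℝ} {f f' f'' : ℝ → E}
    (h1 : ∀ s ∈ Icc (0:ℝ) τ, HasDerivWithinAt f (f' s) (Icc (0:ℝ) τ) s)
    (h2 : ∀ s ∈ Icc (0:ℝ) τ, HasDerivWithinAt f' (f'' s) (Icc (0:ℝ) τ) s)
    (h3 : ContinuousOn f'' (Icc (0:ℝ) τ)) {x : ℝ} (hx : x ∈ Icc (0:ℝ) τ) :
    f x = f 0 + x • f' 0 + ∫ s in (0:ℝ)..x, (x - s) • f'' s := by
  have hsub : Icc (0:ℝ) x ⊆ Icc (0:ℝ) τ := Icc_subset_Icc_right hx.2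
  have hf : ContinuousOn f (Icc (0:ℝ) τ) := fun s hs => (h1 s hs).continuousWithinAt
  have hf' : ContinuousOn f' (Icc (0:ℝ) τ) := fun s hs => (h2 s hs).continuousWithinAt
  have key := intervalIntegral.integral_eq_sub_of_hasDerivAt_of_le
    (f := fun s => f s + (x - s) • f' s) (f' := fun s => (x - s) • f'' s) hx.1
    (by
      refine (hf.mono hsub).add (ContinuousOn.smul (by fun_prop) (hf'.mono hsub)))
    (by
      intro s hs
      have hn : Icc (0:ℝ) τ ∈ 𝓝 s := Icc_mem_nhds hs.1 (hs.2.trans_le hx.2)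
      have hm : s ∈ Icc (0:ℝ) τ := mem_of_mem_nhds hn
      have d1 := (h1 s hm).hasDerivAt hn
      have d2 := (h2 s hm).hasDerivAt hn
      have d3 : HasDerivAt (fun y : ℝ => x - y) (-1) s := (hasDerivAt_id s).const_sub x
      refine (d1.add (d3.smul d2)).congr_deriv ?_
      simp)
    (by
      apply ContinuousOn.intervalIntegrable
      rw [uIcc_of_le hx.1]
      exact ContinuousOn.smul (by fun_prop) (h3.mono hsub))
  rw [key]
  simp

lemma quad_taylor_int {E : Type*} [NormedAddCommGroup E] [NormedSpace ℝ E] [CompleteSpace E]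
    {τ : ℝ} (hτ : 0 ≤ τ) {f f' f'' : ℝ → E}
    (h1 : ∀ s ∈ Icc (0:ℝ) τ, HasDerivWithinAt f (f' s) (Icc (0:ℝ) τ) s)
    (h2 : ∀ s ∈ Icc (0:ℝ) τ, HasDerivWithinAt f' (f'' s) (Icc (0:ℝ) τ) s)
    (h3 : ContinuousOn f'' (Icc (0:ℝ) τ)) :
    ∫ s in (0:ℝ)..τ, f s = τ • f 0 + (τ ^ 2 / 2) • f' 0 +
      ∫ s in (0:ℝ)..τ, ((τ - s) ^ 2 / 2) • f'' s := by
  have hf : ContinuousOn f (Icc (0:ℝ) τ) := fun s hs => (h1 s hs).continuousWithinAt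
  have hf' : ContinuousOn f' (Icc (0:ℝ) τ) := fun s hs => (h2 s hs).continuousWithinAt
  have i1 : IntervalIntegrable (fun s => ((τ - s) ^ 2 / 2) • f'' s) volume 0 τ := by
    apply ContinuousOn.intervalIntegrable
    rw [uIcc_of_le hτ]
    exact ContinuousOn.smul (by fun_prop) h3
  have i2 : IntervalIntegrable f volume 0 τ := by
    apply ContinuousOn.intervalIntegrable
    rwa [uIcc_of_le hτ]
  have key := intervalIntegral.integral_eq_sub_of_hasDerivAt_of_le
    (f := fun s => ((τ - s) ^ 2 / 2) • f' s + (τ - s) • f s)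
    (f' := fun s => ((τ - s) ^ 2 / 2) • f'' s - f s) hτ
    (by
      exact (ContinuousOn.smul (by fun_prop) hf').add (ContinuousOn.smul (by fun_prop) hf))
    (by
      intro s hs
      have hn : Icc (0:ℝ) τ ∈ 𝓝 s := Icc_mem_nhds hs.1 hs.2
      have hm : s ∈ Icc (0:ℝ) τ := mem_of_mem_nhds hn
      have d1 := (h1 s hm).hasDerivAt hn
      have d2 := (h2 s hm).hasDerivAt hn
      have d3 : HasDerivAt (fun y : ℝ => τ - y) (-1) s := (hasDerivAt_id s).const_sub τ
      have d4 : HasDerivAt (fun y : ℝ => (τ - y) ^ 2 / 2) (-(τ - s)) s := by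
        refine ((d3.pow 2).div_const 2).congr_deriv ?_
        simp; ring
      refine ((d4.smul d2).add (d3.smul d1)).congr_deriv ?_
      simp only [neg_smul, one_smul]
      abel)
    (i1.sub i2)
  rw [intervalIntegral.integral_sub i1 i2] at key
  simp only [sub_self, sub_zero] at key
  rw [sub_eq_iff_eq_add] at key
  rw [key]
  simp only [ne_eq, OfNat.ofNat_ne_zero, not_false_eq_true, zero_pow, zero_div, zero_smul]
  abel

/-- Decomposition of a weighted integral of `ψ''`. -/
lemma quad_decomp {E : Type*} [NormedAddCommGroup E] [NormedSpace ℝ E] [CompleteSpace E]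
    {τ M C : ℝ} (hM : 0 ≤ M) (hC : 0 ≤ C) (hτ : 0 < τ)
    {T : ℝ → E →L[ℝ] E} {A : E →L[ℝ] E}
    (hTM : ∀ t ∈ Icc (0:ℝ) τ, ‖T t‖ ≤ M)
    (hTd : ∀ x : E, ∀ t ∈ Icc (0:ℝ) τ,
          HasDerivWithinAt (fun s => T s x) (A (T t x)) (Icc (0:ℝ) τ) t)
    (hcomm : ∀ t ∈ Icc (0:ℝ) τ, ∀ x : E, A (T t x) = T t (A x))
    (hsm : ∀ t ∈ Ioc (0:ℝ) τ, ‖A.comp (T t)‖ ≤ C / t)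
    {p p' p'' : ℝ → E}
    (hp : ContinuousOn p (Icc (0:ℝ) τ))
    (hp' : ContinuousOn p' (Icc (0:ℝ) τ))
    (hp'' : ContinuousOn p'' (Icc (0:ℝ) τ))
    (hb1 : ∀ s ∈ Icc (0:ℝ) τ, ‖p' s‖ ≤ C)
    (hb2 : ∀ s ∈ Icc (0:ℝ) τ, ‖p'' s‖ ≤ C)
    {φ₀ : E} (hφ : ‖A φ₀‖ ≤ C) (hpφ : ∀ s ∈ Icc (0:ℝ) τ, ‖p s - φ₀‖ ≤ C * τ)
    {x L : ℝ} (hx : x ∈ Icc (0:ℝ) τ) (hL : 0 ≤ L) {κ : ℝ → ℝ} (hκ : Continuous κ)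
    (hκb : ∀ s ∈ Icc (0:ℝ) x, |κ s| ≤ L * (τ - s)) :
    ∃ w r : E, ∫ s in (0:ℝ)..x,
        κ s • T (τ - s) ((p'' s - A (p' s)) - A (p' s - A (p s))) = A w + r ∧
      ‖w‖ ≤ (C ^ 2 + 3 * M * C) * L * τ ^ 2 ∧ ‖r‖ ≤ (C ^ 2 + 3 * M * C) * L * τ ^ 2 := by
  have hsub : Icc (0:ℝ) x ⊆ Icc (0:ℝ) τ := Icc_subset_Icc_right hx.2
  have hmaps : ∀ s ∈ Icc (0:ℝ) τ, τ - s ∈ Icc (0:ℝ) τ := fun y hy =>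
    ⟨by linarith [hy.2], by linarith [hy.1]⟩
  set W : ℝ → E := fun s => κ s • T (τ - s) (A (p s - φ₀) + A φ₀ - (2:ℝ) • p' s) with hW
  set R : ℝ → E := fun s => κ s • T (τ - s) (p'' s) with hR
  have cW : ContinuousOn W (Icc (0:ℝ) τ) := by
    refine hκ.continuousOn.smul (quad_continuousOn hTM hTd ?_)
    exact ((A.continuous.comp_continuousOn (hp.sub continuousOn_const)).add
      continuousOn_const).sub (hp'.const_smul (2:ℝ))
  have cR : ContinuousOn R (Icc (0:ℝ) τ) :=
    hκ.continuousOn.smul (quad_continuousOn hTM hTd hp'')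
  have iW : IntervalIntegrable W volume 0 x := by
    apply ContinuousOn.intervalIntegrable
    rw [uIcc_of_le hx.1]
    exact cW.mono hsub
  have iAW : IntervalIntegrable (fun s => A (W s)) volume 0 x := by
    apply ContinuousOn.intervalIntegrable
    rw [uIcc_of_le hx.1]
    exact A.continuous.comp_continuousOn (cW.mono hsub)
  have iR : IntervalIntegrable R volume 0 x := by
    apply ContinuousOn.intervalIntegrable
    rw [uIcc_of_le hx.1]
    exact cR.mono hsub
  have hD : 0 ≤ (C ^ 2 + 3 * M * C) * L * τ := by positivity
  have hxτ : (C ^ 2 + 3 * M * C) * L * τ * |x - 0| ≤ (C ^ 2 + 3 * M * C) * L * τ ^ 2 := by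
    rw [sub_zero, abs_of_nonneg hx.1]
    calc _ ≤ (C ^ 2 + 3 * M * C) * L * τ * τ := mul_le_mul_of_nonneg_left hx.2 hD
      _ = _ := by ring
  refine ⟨∫ s in (0:ℝ)..x, W s, ∫ s in (0:ℝ)..x, R s, ?_, ?_, ?_⟩
  · rw [← ContinuousLinearMap.intervalIntegral_comp_comm A iW,
      ← intervalIntegral.integral_add (iAW) iR]
    apply intervalIntegral.integral_congr
    intro s hs
    rw [uIcc_of_le hx.1] at hs
    have ht := hmaps s (hsub hs)
    simp only [hW, hR, map_smul]
    rw [hcomm _ ht, ← smul_add, ← map_add]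
    congr 2
    simp only [map_sub, map_add, map_smul, two_smul]
    abel
  · refine (intervalIntegral.norm_integral_le_of_norm_le_const
      (C := (C ^ 2 + 3 * M * C) * L * τ) ?_).trans hxτ
    intro s hs
    rw [uIoc_of_le hx.1] at hs
    have hs1 : s ∈ Icc (0:ℝ) x := ⟨hs.1.le, hs.2⟩
    have hs2 := hsub hs1
    have ht := hmaps s hs2
    have hk := hκb s hs1
    have n2 : ‖T (τ - s) (A φ₀)‖ ≤ M * C :=
      (T (τ - s)).le_of_opNorm_le_of_le (hTM _ ht) hφ
    have n3 : ‖T (τ - s) ((2:ℝ) • p' s)‖ ≤ M * (2 * C) := by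
      refine (T (τ - s)).le_of_opNorm_le_of_le (hTM _ ht) ?_
      rw [norm_smul, Real.norm_eq_abs, abs_two]
      linarith [hb1 s hs2]
    have n1 : |κ s| * ‖T (τ - s) (A (p s - φ₀))‖ ≤ L * (C * (C * τ)) := by
      rcases ht.1.eq_or_lt with h0 | h0
      · have : |κ s| = 0 := le_antisymm (by rw [← h0] at hk; simpa using hk) (abs_nonneg _)
        rw [this, zero_mul]
        positivity
      · have : ‖(A.comp (T (τ - s))) (p s - φ₀)‖ ≤ C / (τ - s) * (C * τ) :=
          (A.comp (T (τ - s))).le_of_opNorm_le_of_le (hsm _ ⟨h0, ht.2⟩) (hpφ s hs2)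
        rw [ContinuousLinearMap.comp_apply, hcomm _ ht] at this
        calc _ ≤ (L * (τ - s)) * (C / (τ - s) * (C * τ)) := by gcongr
          _ = _ := by field_simp
    have hkτ : |κ s| ≤ L * τ := hk.trans (mul_le_mul_of_nonneg_left ht.2 hL)
    simp only [hW, norm_smul, Real.norm_eq_abs, map_sub (T (τ - s)), map_add (T (τ - s))]
    calc _ ≤ |κ s| * (‖T (τ - s) (A (p s - φ₀))‖ + ‖T (τ - s) (A φ₀)‖
            + ‖T (τ - s) ((2:ℝ) • p' s)‖) := by
          gcongr
          exact (norm_sub_le _ _).trans (by gcongr; exact norm_add_le _ _)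
      _ = |κ s| * ‖T (τ - s) (A (p s - φ₀))‖ + |κ s| * (‖T (τ - s) (A φ₀)‖
            + ‖T (τ - s) ((2:ℝ) • p' s)‖) := by ring
      _ ≤ L * (C * (C * τ)) + (L * τ) * (M * C + M * (2 * C)) := by gcongr
      _ = _ := by ring
  · refine (intervalIntegral.norm_integral_le_of_norm_le_const
      (C := (C ^ 2 + 3 * M * C) * L * τ) ?_).trans hxτ
    intro s hs
    rw [uIoc_of_le hx.1] at hs
    have hs1 : s ∈ Icc (0:ℝ) x := ⟨hs.1.le, hs.2⟩
    have hs2 := hsub hs1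
    have ht := hmaps s hs2
    have hk := hκb s hs1
    have hkτ : |κ s| ≤ L * τ := hk.trans (mul_le_mul_of_nonneg_left ht.2 hL)
    have n2 : ‖T (τ - s) (p'' s)‖ ≤ M * C :=
      (T (τ - s)).le_of_opNorm_le_of_le (hTM _ ht) (hb2 s hs2)
    simp only [hR, norm_smul, Real.norm_eq_abs]
    calc _ ≤ (L * τ) * (M * C) := by gcongr
      _ ≤ (C ^ 2 + 3 * M * C) * L * τ := by
        have : 0 ≤ (C ^ 2 + 2 * M * C) * L * τ := by positivity
        nlinarith

theorem second_order_quadrature_decomposition_improved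
    (M C : ℝ) (hM : 0 ≤ M) (hC : 0 ≤ C)
    (m : ℕ) (b c : Fin m → ℝ)
    (hb1 : ∑ k, b k = 1) (hb2 : ∑ k, b k * c k = 1 / 2)
    (hc : ∀ k, c k ∈ Set.Icc (0:ℝ) 1) :
    ∃ K : ℝ,
      ∀ (E : Type*) [NormedAddCommGroup E] [NormedSpace ℝ E] [CompleteSpace E]
        (τ : ℝ), 0 < τ →
      ∀ (T : ℝ → E →L[ℝ] E) (A : E →L[ℝ] E),
      (∀ t ∈ Set.Icc (0:ℝ) τ, ‖T t‖ ≤ M) →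
      (∀ x : E, ∀ t ∈ Set.Icc (0:ℝ) τ,
          HasDerivWithinAt (fun s => T s x) (A (T t x)) (Set.Icc (0:ℝ) τ) t) →
      (∀ t ∈ Set.Icc (0:ℝ) τ, ∀ x : E, A (T t x) = T t (A x)) →
      (∀ t ∈ Set.Ioc (0:ℝ) τ, ‖A.comp (T t)‖ ≤ C / t) →
      ∀ (ψhat ψhat' ψhat'' : ℝ → E),
      (∀ s ∈ Set.Icc (0:ℝ) τ, HasDerivWithinAt ψhat (ψhat' s) (Set.Icc (0:ℝ) τ) s) →
      (∀ s ∈ Set.Icc (0:ℝ) τ, HasDerivWithinAt ψhat' (ψhat'' s) (Set.Icc (0:ℝ) τ) s) →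
      ContinuousOn ψhat' (Set.Icc (0:ℝ) τ) →
      ContinuousOn ψhat'' (Set.Icc (0:ℝ) τ) →
      (∀ s ∈ Set.Icc (0:ℝ) τ, ‖ψhat s‖ ≤ C) →
      (∀ s ∈ Set.Icc (0:ℝ) τ, ‖ψhat' s‖ ≤ C) →
      (∀ s ∈ Set.Icc (0:ℝ) τ, ‖ψhat'' s‖ ≤ C) →
      ∀ φ₀ : E, ‖A φ₀‖ ≤ C →
      (∀ s ∈ Set.Icc (0:ℝ) τ, ‖ψhat s - φ₀‖ ≤ C * τ) →
      ∃ w r : E,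
        (∫ s in (0:ℝ)..τ, T (τ - s) (ψhat s)) -
            τ • ∑ k, b k • T (τ - τ * c k) (ψhat (τ * c k)) = A w + r ∧
        ‖w‖ ≤ K * τ ^ 3 ∧ ‖r‖ ≤ K * τ ^ 3 := by
  refine ⟨(1 / 2 + ∑ k, |b k|) * (C ^ 2 + 3 * M * C), ?_⟩
  intro E _ _ _ τ hτ T A hTM hTd hcomm hsm p p' p'' hp1 hp2 cp' cp'' _ hbp' hbp'' φ₀ hφ hpφ
  have cp : ContinuousOn p (Icc (0:ℝ) τ) := fun s hs => (hp1 s hs).continuousWithinAt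
  set D := C ^ 2 + 3 * M * C with hD
  have f1 : ∀ s ∈ Icc (0:ℝ) τ, HasDerivWithinAt (fun s => T (τ - s) (p s))
      (T (τ - s) (p' s - A (p s))) (Icc (0:ℝ) τ) s := fun s hs =>
    quad_hasDeriv hTM hTd hcomm hs (hp1 s hs)
  have f2 : ∀ s ∈ Icc (0:ℝ) τ, HasDerivWithinAt (fun s => T (τ - s) (p' s - A (p s)))
      (T (τ - s) ((p'' s - A (p' s)) - A (p' s - A (p s)))) (Icc (0:ℝ) τ) s := fun s hs =>
    quad_hasDeriv (u := fun s => p' s - A (p s)) hTM hTd hcomm hs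
      ((hp2 s hs).sub (A.hasFDerivAt.comp_hasDerivWithinAt s (hp1 s hs)))
  have f3 : ContinuousOn (fun s => T (τ - s) ((p'' s - A (p' s)) - A (p' s - A (p s))))
      (Icc (0:ℝ) τ) := by
    refine quad_continuousOn hTM hTd ?_
    exact (cp''.sub (A.continuous.comp_continuousOn cp')).sub
      (A.continuous.comp_continuousOn (cp'.sub (A.continuous.comp_continuousOn cp)))
  have hxk : ∀ k, τ * c k ∈ Icc (0:ℝ) τ := fun k =>
    ⟨mul_nonneg hτ.le (hc k).1, mul_le_of_le_one_right hτ.le (hc k).2⟩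
  obtain ⟨w₀, r₀, e₀, hw₀, hr₀⟩ := quad_decomp hM hC hτ hTM hTd hcomm hsm cp cp' cp'' hbp' hbp''
    hφ hpφ (x := τ) (L := τ / 2) ⟨hτ.le, le_rfl⟩ (by positivity)
    (κ := fun s => (τ - s) ^ 2 / 2) (by fun_prop) (by
      intro s hs
      rw [abs_of_nonneg (by positivity)]
      nlinarith [hs.1, hs.2])
  have hk : ∀ k, ∃ w r : E, ∫ s in (0:ℝ)..(τ * c k),
        (τ * c k - s) • T (τ - s) ((p'' s - A (p' s)) - A (p' s - A (p s))) = A w + r ∧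
      ‖w‖ ≤ D * 1 * τ ^ 2 ∧ ‖r‖ ≤ D * 1 * τ ^ 2 := fun k =>
    quad_decomp hM hC hτ hTM hTd hcomm hsm cp cp' cp'' hbp' hbp''
      hφ hpφ (L := 1) (hxk k) zero_le_one (κ := fun s => τ * c k - s) (by fun_prop) (by
        intro s hs
        rw [abs_of_nonneg (by linarith [hs.2])]
        linarith [(hxk k).2])
  choose w r e hw hr using hk
  have hbound : ∀ (v₀ : E) (v : Fin m → E), ‖v₀‖ ≤ D * (τ / 2) * τ ^ 2 →
      (∀ k, ‖v k‖ ≤ D * 1 * τ ^ 2) →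
      ‖v₀ - τ • ∑ k, b k • v k‖ ≤ (1 / 2 + ∑ k, |b k|) * D * τ ^ 3 := by
    intro v₀ v h0 h1
    calc _ ≤ ‖v₀‖ + ‖τ • ∑ k, b k • v k‖ := norm_sub_le _ _
      _ ≤ D * (τ / 2) * τ ^ 2 + τ * ∑ k, |b k| * (D * 1 * τ ^ 2) := by
        rw [norm_smul, Real.norm_eq_abs, abs_of_pos hτ]
        gcongr
        refine (norm_sum_le _ _).trans (Finset.sum_le_sum fun k _ => ?_)
        rw [norm_smul, Real.norm_eq_abs]
        gcongr
        exact h1 k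
      _ = _ := by rw [← Finset.sum_mul]; ring
  refine ⟨w₀ - τ • ∑ k, b k • w k, r₀ - τ • ∑ k, b k • r k, ?_, hbound _ _ hw₀ hw,
    hbound _ _ hr₀ hr⟩
  · rw [quad_taylor_int hτ.le f1 f2 f3, e₀]
    have hq : ∀ k, T (τ - τ * c k) (p (τ * c k)) = T (τ - 0) (p 0) +
        (τ * c k) • T (τ - 0) (p' 0 - A (p 0)) + (A (w k) + r k) := fun k => by
      rw [← e k]
      exact quad_taylor f1 f2 f3 (hxk k)
    have hsum : ∑ k, b k • T (τ - τ * c k) (p (τ * c k)) = T (τ - 0) (p 0) +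
        (τ / 2) • T (τ - 0) (p' 0 - A (p 0)) +
        (∑ k, b k • A (w k) + ∑ k, b k • r k) := by
      simp_rw [hq, smul_add, Finset.sum_add_distrib, smul_smul]
      rw [← Finset.sum_smul, ← Finset.sum_smul, hb1, one_smul]
      have : ∑ k, b k * (τ * c k) = τ / 2 := by
        calc _ = τ * ∑ k, b k * c k := by
              rw [Finset.mul_sum]; exact Finset.sum_congr rfl fun k _ => by ring
          _ = _ := by rw [hb2]; ring
      rw [this]
    rw [hsum]
    simp only [map_sub A, map_smul, map_sum, smul_add, smul_smul]
    rw [show τ * (τ / 2) = τ ^ 2 / 2 by ring]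
    abel
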